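/- Let I ∈ ℂ[x_ε : ε ∈ {0,1}^g] be a polynomial such that I(Θ[0…0](τ,0), …, Θ[1…1](τ,0)) = 0 for all τ ∈ H_g. Then for every τ ∈ H_g the function f_I(z) := Σ_{ε} (∂I/∂x_ε)(Θ[0…0](τ,0),…,Θ[1…1](τ,0)) · Θ[ε](τ,z) satisfies: (a) all second partial derivatives ∂²f_I/∂z_j∂z_k(0) = 0 (since the τ_{jk}-derivative of I(Θ[·](τ,0)) vanishes and the heat equation holds); and (b) if moreover I is homogeneous, then f_I(0) = deg(I) · I(Θ[·](τ,0)) = 0 by Euler's formula. Hence f_I ∈ Γ_00. -/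

import Mathlib

open Complex BigOperators

noncomputable section

/-- The Siegel upper half-space: symmetric complex matrices with
positive-definite imaginary part. -/
def SiegelUpper (g : ℕ) : Set (Matrix (Fin g) (Fin g) ℂ) :=
  {τ | τ.IsSymm ∧ (Matrix.of fun i j => (τ i j).im).PosDef}

/-- The bilinear pairing vᵀ τ w. -/
def qform {g : ℕ} (τ : Matrix (Fin g) (Fin g) ℂ) (v w : Fin g → ℂ) : ℂ :=
  ∑ i, ∑ j, v i * τ i j * w j

/-- The dot product vᵀ w. -/
def dotc {g : ℕ} (v w : Fin g → ℂ) : ℂ := ∑ i, v i * w i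

/-- The Riemann theta function θ(τ,z). -/
def theta {g : ℕ} (τ : Matrix (Fin g) (Fin g) ℂ) (z : Fin g → ℂ) : ℂ :=
  ∑' n : Fin g → ℤ, Complex.exp ((Real.pi : ℂ) * Complex.I *
    (qform τ (fun i => (n i : ℂ)) (fun i => (n i : ℂ))
      + 2 * dotc (fun i => (n i : ℂ)) z))

/-- The theta function with characteristic [ε;δ] (entries of ε, δ in {0,1},
used via ε/2, δ/2). -/
def thetaChar {g : ℕ} (ε δ : Fin g → ℤ) (τ : Matrix (Fin g) (Fin g) ℂ)
    (z : Fin g → ℂ) : ℂ :=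
  ∑' n : Fin g → ℤ, Complex.exp ((Real.pi : ℂ) * Complex.I *
    (qform τ (fun i => (n i : ℂ) + (ε i : ℂ) / 2) (fun i => (n i : ℂ) + (ε i : ℂ) / 2)
      + 2 * dotc (fun i => (n i : ℂ) + (ε i : ℂ) / 2) (fun i => z i + (δ i : ℂ) / 2)))

/-- The second-order theta function Θ[ε](τ,z) = θ[ε;0](2τ,2z). -/
def theta2 {g : ℕ} (ε : Fin g → ℤ) (τ : Matrix (Fin g) (Fin g) ℂ)
    (z : Fin g → ℂ) : ℂ :=
  thetaChar ε 0 (Matrix.of fun i j => 2 * τ i j) (fun i => 2 * z i)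

/-- Lift of a mod-2 characteristic to an integer vector with entries in {0,1}. -/
def liftChar {g : ℕ} (ε : Fin g → ZMod 2) : Fin g → ℤ := fun i => ((ε i).val : ℤ)

/-- Directional derivative of a function ℂ^g → ℂ in the j-th coordinate. -/
def dirDeriv {g : ℕ} (j : Fin g) (f : (Fin g → ℂ) → ℂ) : (Fin g → ℂ) → ℂ :=
  fun z => deriv (fun t : ℂ => f (z + t • (Pi.single j 1 : Fin g → ℂ))) 0


lemma summable_prod_comp_pi {ι κ : Type*} [Fintype ι] [DecidableEq ι] {f : ι → κ → ℝ}
    (hf₀ : ∀ i n, 0 ≤ f i n) (hf : ∀ i, Summable (f i)) :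
    Summable fun n : ι → κ => ∏ i, f i (n i) := by
  classical
  refine summable_of_sum_le (c := ∏ i, ∑' n, f i n)
    (fun n => Finset.prod_nonneg fun i _ => hf₀ i (n i)) fun s => ?_
  have hs : s ⊆ Fintype.piFinset fun i => s.image fun n => n i := fun n hn =>
    Fintype.mem_piFinset.2 fun i => Finset.mem_image_of_mem _ hn
  calc ∑ n ∈ s, ∏ i, f i (n i)
      ≤ ∑ n ∈ Fintype.piFinset fun i => s.image fun n => n i, ∏ i, f i (n i) :=
        Finset.sum_le_sum_of_subset_of_nonneg hs
          fun n _ _ => Finset.prod_nonneg fun i _ => hf₀ i (n i)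
    _ = ∏ i, ∑ n ∈ s.image fun n => n i, f i n := (Finset.prod_univ_sum _ _).symm
    _ ≤ ∏ i, ∑' n, f i n := Finset.prod_le_prod
        (fun i _ => Finset.sum_nonneg fun n _ => hf₀ i n)
        fun i _ => (hf i).sum_le_tsum _ fun n _ => hf₀ i n

lemma summable_exp_neg_abs_int : Summable fun n : ℤ => Real.exp (-|(n : ℝ)|) := by
  have h : Summable fun n : ℕ => Real.exp (-(n : ℝ)) := Real.summable_exp_neg_nat
  exact Summable.of_nat_of_neg (by simpa using h) (by simpa using h)

lemma summable_exp_neg_sq_add_abs {c : ℝ} (hc : 0 < c) (C a : ℝ) :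
    Summable fun n : ℤ => Real.exp (-c * ((n : ℝ) + a) ^ 2 + C * |(n : ℝ) + a|) := by
  refine Summable.of_nonneg_of_le (fun n => (Real.exp_pos _).le) (fun n => ?_)
    (summable_exp_neg_abs_int.mul_left (Real.exp ((C + 1) ^ 2 / (4 * c) + |a|)))
  rw [← Real.exp_add, Real.exp_le_exp]
  have h₁ : |(n : ℝ)| ≤ |(n : ℝ) + a| + |a| := by
    simpa using abs_sub ((n : ℝ) + a) a
  have h₂ : -c * ((n : ℝ) + a) ^ 2 + (C + 1) * |(n : ℝ) + a| ≤ (C + 1) ^ 2 / (4 * c) := by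
    rw [le_div_iff₀ (by positivity), ← sq_abs]
    nlinarith [sq_nonneg (2 * c * |(n : ℝ) + a| - (C + 1))]
  linarith

lemma hasDerivAt_tsum_mul_exp {ι : Type*} {c a b : ι → ℂ} {u : ι → ℝ} (hu : Summable u)
    {r : ℝ} (hr : 0 < r)
    (h : ∀ n, ∀ w ∈ Metric.ball (0 : ℂ) r, ‖c n * exp (a n + w * b n)‖ ≤ u n) :
    HasDerivAt (fun w : ℂ => ∑' n, c n * exp (a n + w * b n))
      (∑' n, c n * b n * exp (a n)) 0 := by
  have hterm : ∀ n w, HasDerivAt (fun w : ℂ => c n * exp (a n + w * b n))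
      (c n * (exp (a n + w * b n) * b n)) w := fun n w => by
    simpa using ((((hasDerivAt_id w).mul_const (b n)).const_add (a n)).cexp).const_mul (c n)
  have hd : ∀ n, DifferentiableOn ℂ (fun w : ℂ => c n * exp (a n + w * b n))
      (Metric.ball 0 r) := fun n w _ => (hterm n w).differentiableAt.differentiableWithinAt
  have h₀ : (0 : ℂ) ∈ Metric.ball (0 : ℂ) r := Metric.mem_ball_self hr
  have hD := (differentiableOn_tsum_of_summable_norm hu hd Metric.isOpen_ball h).differentiableAt
    (Metric.isOpen_ball.mem_nhds h₀)
  have hS := (hasSum_deriv_of_summable_norm hu hd Metric.isOpen_ball h h₀).tsum_eq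
  convert! hD.hasDerivAt using 1
  rw [← hS]
  refine tsum_congr fun n => ?_
  rw [(hterm n 0).deriv]
  simp only [zero_mul, add_zero]
  ring

lemma MvPolynomial.hasDerivAt_eval {σ 𝕜 : Type*} [Fintype σ] [NontriviallyNormedField 𝕜]
    (p : MvPolynomial σ 𝕜) {x : 𝕜 → σ → 𝕜} {x' : σ → 𝕜} {s : 𝕜}
    (hx : ∀ i, HasDerivAt (fun t => x t i) (x' i) s) :
    HasDerivAt (fun t => MvPolynomial.eval (x t) p)
      (∑ i, MvPolynomial.eval (x s) (MvPolynomial.pderiv i p) * x' i) s := by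
  classical
  induction p using MvPolynomial.induction_on with
  | C a => simpa using hasDerivAt_const s a
  | add p q hp hq =>
    simpa [add_mul, Finset.sum_add_distrib] using! hp.add hq
  | mul_X p i hp =>
    have := hp.mul (hx i)
    simp only [map_mul, MvPolynomial.eval_X]
    convert! this using 1
    simp only [Derivation.leibniz, MvPolynomial.pderiv_X, smul_eq_mul, map_add, map_mul,
      MvPolynomial.eval_X, add_mul, Finset.sum_add_distrib, Finset.sum_mul]
    rw [add_comm]
    congr 1
    · exact Finset.sum_congr rfl fun _ _ => by ring
    · rw [Finset.sum_eq_single i]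
      · simp
      · intro b _ hb
        simp [hb.symm]
      · simp

/-- The quadratic form of the real matrix `Y` is bounded below by `c * |x|²`. -/
def QuadraticLowerBound {g : ℕ} (c : ℝ) (Y : Matrix (Fin g) (Fin g) ℝ) : Prop :=
  ∀ x : Fin g → ℝ, c * ∑ i, x i ^ 2 ≤ ∑ i, ∑ j, x i * Y i j * x j

lemma sum_sq_pos_of_ne_zero {g : ℕ} {x : Fin g → ℝ} (hx : x ≠ 0) : 0 < ∑ i, x i ^ 2 := by
  obtain ⟨i, hi⟩ := Function.ne_iff.1 hx
  exact Finset.sum_pos' (fun i _ => sq_nonneg _) ⟨i, Finset.mem_univ _, sq_pos_of_ne_zero hi⟩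

lemma Matrix.PosDef.exists_quadraticLowerBound {g : ℕ} {Y : Matrix (Fin g) (Fin g) ℝ}
    (hY : Y.PosDef) : ∃ c > 0, QuadraticLowerBound c Y := by
  have hpos : ∀ x : Fin g → ℝ, x ≠ 0 → 0 < ∑ i, ∑ j, x i * Y i j * x j := fun x hx => by
    simpa [dotProduct, Matrix.mulVec, Finset.mul_sum, mul_assoc] using
      hY.dotProduct_mulVec_pos hx
  have hne : ∀ x ∈ Metric.sphere (0 : Fin g → ℝ) 1, x ≠ 0 := fun x hx =>
    ne_zero_of_mem_unit_sphere ⟨x, hx⟩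
  have hnorm : ∀ x : Fin g → ℝ, x ≠ 0 → ‖x‖⁻¹ • x ∈ Metric.sphere (0 : Fin g → ℝ) 1 :=
    fun x hx => by simp [norm_smul, hx]
  rcases (Metric.sphere (0 : Fin g → ℝ) 1).eq_empty_or_nonempty with he | hn
  · refine ⟨1, one_pos, fun x => ?_⟩
    obtain rfl : x = 0 := by_contra fun hx => by simpa [he] using hnorm x hx
    simp
  · have hcont : ContinuousOn
        (fun x : Fin g → ℝ => (∑ i, ∑ j, x i * Y i j * x j) / ∑ i, x i ^ 2)
        (Metric.sphere 0 1) :=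
      ContinuousOn.div (by fun_prop) (by fun_prop)
        fun x hx => (sum_sq_pos_of_ne_zero (hne x hx)).ne'
    obtain ⟨x₀, hx₀, hmin⟩ := (isCompact_sphere (0 : Fin g → ℝ) 1).exists_isMinOn hn hcont
    refine ⟨_, div_pos (hpos x₀ (hne x₀ hx₀)) (sum_sq_pos_of_ne_zero (hne x₀ hx₀)),
      fun x => ?_⟩
    rcases eq_or_ne x 0 with rfl | hx
    · simp
    rw [← le_div_iff₀ (sum_sq_pos_of_ne_zero hx)]
    refine (hmin (hnorm x hx)).trans_eq ?_
    have hx' : ‖x‖⁻¹ ^ 2 ≠ 0 := by simpa using hx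
    have h₁ : ∑ i, ∑ j, (‖x‖⁻¹ • x) i * Y i j * (‖x‖⁻¹ • x) j
        = ‖x‖⁻¹ ^ 2 * ∑ i, ∑ j, x i * Y i j * x j := by
      simp only [Finset.mul_sum, Pi.smul_apply, smul_eq_mul]
      exact Finset.sum_congr rfl fun i _ => Finset.sum_congr rfl fun j _ => by ring
    have h₂ : ∑ i, (‖x‖⁻¹ • x) i ^ 2 = ‖x‖⁻¹ ^ 2 * ∑ i, x i ^ 2 := by
      simp only [Finset.mul_sum, Pi.smul_apply, smul_eq_mul, mul_pow]
    simp only [h₁, h₂]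
    exact mul_div_mul_left _ _ hx'

lemma QuadraticLowerBound.posDef {g : ℕ} {c : ℝ} (hc : 0 < c) {Y : Matrix (Fin g) (Fin g) ℝ}
    (hY : QuadraticLowerBound c Y) (hs : Y.IsSymm) : Y.PosDef := by
  refine Matrix.PosDef.of_dotProduct_mulVec_pos (by simpa [Matrix.IsHermitian] using hs.eq)
    fun x hx => ?_
  have h := (mul_pos hc (sum_sq_pos_of_ne_zero hx)).trans_le (hY x)
  simpa [dotProduct, Matrix.mulVec, Finset.mul_sum, mul_assoc] using h

/-- The index `n + ε / 2` of a term of the theta series. -/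
def thetaIndex {g : ℕ} (ε n : Fin g → ℤ) (i : Fin g) : ℝ := n i + ε i / 2

/-- The exponent of the `n`-th term of the series of the second order theta function. -/
def theta2Exponent {g : ℕ} (ε : Fin g → ℤ) (τ : Matrix (Fin g) (Fin g) ℂ) (z : Fin g → ℂ)
    (n : Fin g → ℤ) : ℂ :=
  2 * Real.pi * I * (qform τ (fun i => (thetaIndex ε n i : ℂ)) (fun i => (thetaIndex ε n i : ℂ))
    + 2 * dotc (fun i => (thetaIndex ε n i : ℂ)) z)

lemma theta2_eq_tsum {g : ℕ} (ε : Fin g → ℤ) (τ : Matrix (Fin g) (Fin g) ℂ) (z : Fin g → ℂ) :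
    theta2 ε τ z = ∑' n, exp (theta2Exponent ε τ z n) := by
  refine tsum_congr fun n => congrArg exp ?_
  simp only [theta2Exponent, qform, dotc, thetaIndex, Matrix.of_apply, Pi.zero_apply, mul_add,
    Finset.mul_sum]
  push_cast
  congr 1
  · exact Finset.sum_congr rfl fun i _ => Finset.sum_congr rfl fun j _ => by ring
  · exact Finset.sum_congr rfl fun i _ => by ring

/-- A majorant of the terms of the theta series. -/
def thetaMajorant {g : ℕ} (c C : ℝ) (ε n : Fin g → ℤ) : ℝ :=
  Real.exp (∑ i, (-c * thetaIndex ε n i ^ 2 + C * |thetaIndex ε n i|))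

lemma summable_thetaMajorant {g : ℕ} {c : ℝ} (hc : 0 < c) (C : ℝ) (ε : Fin g → ℤ) :
    Summable (thetaMajorant c C ε) := by
  simp only [funext fun n => thetaMajorant.eq_1 c C ε n, Real.exp_sum]
  exact summable_prod_comp_pi (f := fun i (n : ℤ) =>
    Real.exp (-c * ((n : ℝ) + ε i / 2) ^ 2 + C * |(n : ℝ) + ε i / 2|))
    (fun _ _ => (Real.exp_pos _).le) fun i => summable_exp_neg_sq_add_abs hc C _

lemma norm_exp_theta2Exponent_le {g : ℕ} {ε : Fin g → ℤ} {τ : Matrix (Fin g) (Fin g) ℂ}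
    {z : Fin g → ℂ} {c C : ℝ} (hτ : QuadraticLowerBound c (Matrix.of fun i j => (τ i j).im))
    (hz : ‖z‖ ≤ C) (n : Fin g → ℤ) :
    ‖exp (theta2Exponent ε τ z n)‖ ≤
      thetaMajorant (2 * Real.pi * c) (4 * Real.pi * C) ε n := by
  rw [norm_exp, thetaMajorant, Real.exp_le_exp]
  have hre : (theta2Exponent ε τ z n).re = -(2 * Real.pi) *
      ((∑ i, ∑ j, thetaIndex ε n i * (τ i j).im * thetaIndex ε n j)
        + 2 * ∑ i, thetaIndex ε n i * (z i).im) := by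
    simp [theta2Exponent, qform, dotc, mul_re, mul_im]
  have hlin : -∑ i, thetaIndex ε n i * (z i).im ≤ ∑ i, C * |thetaIndex ε n i| := by
    rw [← Finset.sum_neg_distrib]
    refine Finset.sum_le_sum fun i _ => (neg_le_abs _).trans ?_
    rw [abs_mul, mul_comm]
    gcongr
    exact (abs_im_le_norm _).trans ((norm_le_pi_norm z i).trans hz)
  have hquad := hτ (thetaIndex ε n)
  simp only [Matrix.of_apply] at hquad
  rw [hre, Finset.sum_add_distrib]
  simp only [mul_assoc, neg_mul, Finset.sum_neg_distrib, ← Finset.mul_sum] at hlin hquad ⊢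
  nlinarith [Real.pi_pos]

lemma theta2Exponent_add_smul_single {g : ℕ} (ε : Fin g → ℤ) (τ : Matrix (Fin g) (Fin g) ℂ)
    (z : Fin g → ℂ) (k : Fin g) (t : ℂ) (n : Fin g → ℤ) :
    theta2Exponent ε τ (z + t • (Pi.single k 1 : Fin g → ℂ)) n =
      theta2Exponent ε τ z n + t * (4 * Real.pi * I * thetaIndex ε n k) := by
  simp only [theta2Exponent, dotc, Pi.add_apply, Pi.smul_apply, smul_eq_mul, mul_add,
    Finset.sum_add_distrib, Pi.single_apply, mul_ite, mul_one, mul_zero, Finset.sum_ite_eq',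
    Finset.mem_univ, if_true]
  ring

/-- The symmetric matrix `E_jk + E_kj`. -/
def symmUnit {g : ℕ} (j k : Fin g) : Matrix (Fin g) (Fin g) ℂ :=
  Matrix.single j k 1 + Matrix.single k j 1

lemma qform_add_smul_symmUnit {g : ℕ} (τ : Matrix (Fin g) (Fin g) ℂ) (j k : Fin g) (s : ℂ)
    (v : Fin g → ℂ) :
    qform (τ + s • symmUnit j k) v v = qform τ v v + s * (2 * v j * v k) := by
  have h : ∀ a b : Fin g, ∑ i, ∑ l, v i * (s * Matrix.single a b 1 i l) * v l
      = s * (v a * v b) := fun a b => by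
    rw [Finset.sum_eq_single a, Finset.sum_eq_single b]
    · simp; ring
    · intro l _ hl; simp [Matrix.single, hl.symm]
    · simp
    · intro i _ hi; simp [Matrix.single, hi.symm]
    · simp
  simp only [qform, symmUnit, Matrix.add_apply, Matrix.smul_apply, smul_eq_mul, mul_add,
    add_mul, Finset.sum_add_distrib, h]
  ring

lemma theta2Exponent_add_smul_symmUnit {g : ℕ} (ε : Fin g → ℤ)
    (τ : Matrix (Fin g) (Fin g) ℂ) (z : Fin g → ℂ) (j k : Fin g) (s : ℂ) (n : Fin g → ℤ) :
    theta2Exponent ε (τ + s • symmUnit j k) z n = theta2Exponent ε τ z n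
      + s * (4 * Real.pi * I * (thetaIndex ε n j * thetaIndex ε n k)) := by
  rw [theta2Exponent, qform_add_smul_symmUnit, theta2Exponent]
  ring

lemma QuadraticLowerBound.add_smul_symmUnit {g : ℕ} {c : ℝ} {τ : Matrix (Fin g) (Fin g) ℂ}
    (hτ : QuadraticLowerBound c (Matrix.of fun i j => (τ i j).im)) (j k : Fin g) {s : ℂ}
    (hs : ‖s‖ ≤ c / 4) :
    QuadraticLowerBound (c / 2)
      (Matrix.of fun a b => ((τ + s • symmUnit j k) a b).im) := by
  intro x
  have him : ∀ σ : Matrix (Fin g) (Fin g) ℂ, ∑ a, ∑ b, x a * (σ a b).im * x b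
      = (qform σ (fun i => (x i : ℂ)) (fun i => (x i : ℂ))).im := fun σ => by
    simp [qform, mul_im]
  have h := hτ x
  simp only [Matrix.of_apply] at h ⊢
  rw [him] at h ⊢
  rw [qform_add_smul_symmUnit, add_im]
  have h₁ : (s * (2 * (x j : ℂ) * (x k : ℂ))).im = s.im * (2 * x j * x k) := by
    simp [mul_im]
  have hsq : ∀ i, x i ^ 2 ≤ ∑ i, x i ^ 2 := fun i =>
    Finset.single_le_sum (f := fun i => x i ^ 2) (fun i _ => sq_nonneg _) (Finset.mem_univ i)
  have h₂ : |2 * x j * x k| ≤ 2 * ∑ i, x i ^ 2 := by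
    rw [abs_le]
    constructor <;>
      nlinarith [hsq j, hsq k, sq_nonneg (x j + x k), sq_nonneg (x j - x k)]
  have h₃ : |s.im * (2 * x j * x k)| ≤ c / 4 * (2 * ∑ i, x i ^ 2) := by
    rw [abs_mul]
    exact mul_le_mul ((abs_im_le_norm s).trans hs) h₂ (abs_nonneg _)
      ((norm_nonneg s).trans hs)
  rw [h₁]
  linarith [neg_abs_le (s.im * (2 * x j * x k))]

lemma add_smul_symmUnit_mem_SiegelUpper {g : ℕ} {c : ℝ} (hc : 0 < c)
    {τ : Matrix (Fin g) (Fin g) ℂ} (hτ : τ.IsSymm)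
    (hb : QuadraticLowerBound c (Matrix.of fun i j => (τ i j).im)) (j k : Fin g) {s : ℂ}
    (hs : ‖s‖ ≤ c / 4) : τ + s • symmUnit j k ∈ SiegelUpper g := by
  have hS : (τ + s • symmUnit j k).IsSymm := by
    refine hτ.add (Matrix.IsSymm.smul ?_ s)
    simp [Matrix.IsSymm, symmUnit, Matrix.transpose_single, add_comm]
  refine ⟨hS, (hb.add_smul_symmUnit j k hs).posDef (half_pos hc) ?_⟩
  ext a b
  exact congrArg im (hS.apply a b)

/-- The second derivative `∂²Θ[ε]/∂z_j∂z_k (τ, 0)`, as a series. -/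
def theta2SecondDeriv {g : ℕ} (ε : Fin g → ℤ) (τ : Matrix (Fin g) (Fin g) ℂ) (j k : Fin g) : ℂ :=
  ∑' n, 4 * Real.pi * I * thetaIndex ε n k * (4 * Real.pi * I * thetaIndex ε n j) *
    exp (theta2Exponent ε τ 0 n)

lemma norm_add_smul_single_le {g : ℕ} (z : Fin g → ℂ) (k : Fin g) {t : ℂ} (ht : ‖t‖ ≤ 1) :
    ‖z + t • (Pi.single k 1 : Fin g → ℂ)‖ ≤ ‖z‖ + 1 := by
  refine (norm_add_le _ _).trans ?_
  rw [norm_smul, Pi.norm_single, norm_one, mul_one]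
  gcongr

lemma hasDerivAt_theta2_single {g : ℕ} (ε : Fin g → ℤ) {τ : Matrix (Fin g) (Fin g) ℂ}
    (hτ : τ ∈ SiegelUpper g) (z : Fin g → ℂ) (k : Fin g) :
    HasDerivAt (fun t : ℂ => theta2 ε τ (z + t • (Pi.single k 1 : Fin g → ℂ)))
      (∑' n, 4 * Real.pi * I * thetaIndex ε n k * exp (theta2Exponent ε τ z n)) 0 := by
  obtain ⟨c, hc, hb⟩ := hτ.2.exists_quadraticLowerBound
  have h := hasDerivAt_tsum_mul_exp (c := 1) (a := theta2Exponent ε τ z)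
    (b := fun n => 4 * Real.pi * I * thetaIndex ε n k)
    (summable_thetaMajorant (by positivity : 0 < 2 * Real.pi * c)
      (4 * Real.pi * (‖z‖ + 1)) ε) one_pos fun n t ht => by
        rw [Pi.one_apply, one_mul, ← theta2Exponent_add_smul_single]
        exact norm_exp_theta2Exponent_le hb
          (norm_add_smul_single_le z k (mem_ball_zero_iff.1 ht).le) n
  simpa only [Pi.one_apply, one_mul, theta2_eq_tsum, theta2Exponent_add_smul_single] using h

lemma hasDerivAt_theta2_single_single {g : ℕ} (ε : Fin g → ℤ)
    {τ : Matrix (Fin g) (Fin g) ℂ} (hτ : τ ∈ SiegelUpper g) (j k : Fin g) :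
    HasDerivAt (fun t : ℂ => ∑' n, 4 * Real.pi * I * thetaIndex ε n k *
        exp (theta2Exponent ε τ (0 + t • (Pi.single j 1 : Fin g → ℂ)) n))
      (theta2SecondDeriv ε τ j k) 0 := by
  obtain ⟨c, hc, hb⟩ := hτ.2.exists_quadraticLowerBound
  have h := hasDerivAt_tsum_mul_exp (c := fun n => 4 * Real.pi * I * thetaIndex ε n k)
    (a := theta2Exponent ε τ 0) (b := fun n => 4 * Real.pi * I * thetaIndex ε n j)
    ((summable_thetaMajorant (by positivity : 0 < 2 * Real.pi * c)
      (4 * Real.pi * (‖(0 : Fin g → ℂ)‖ + 1) + 1) ε).mul_left (4 * Real.pi))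
    one_pos fun n t ht => by
      rw [← theta2Exponent_add_smul_single, norm_mul]
      have h₁ := norm_exp_theta2Exponent_le (ε := ε) hb
        (norm_add_smul_single_le 0 j (mem_ball_zero_iff.1 ht).le) n
      have h₂ : ‖4 * Real.pi * I * thetaIndex ε n k‖ ≤
          4 * Real.pi * Real.exp (∑ i, |thetaIndex ε n i|) := by
        have hx : |thetaIndex ε n k| ≤ ∑ i, |thetaIndex ε n i| :=
          Finset.single_le_sum (f := fun i => |thetaIndex ε n i|) (fun i _ => abs_nonneg _)
            (Finset.mem_univ k)
        have hx' := Real.add_one_le_exp (∑ i, |thetaIndex ε n i|)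
        simp only [norm_mul, norm_I, norm_real, Real.norm_eq_abs, abs_of_pos Real.pi_pos,
          norm_ofNat, mul_one]
        gcongr
        linarith
      refine (mul_le_mul h₂ h₁ (norm_nonneg _) (by positivity)).trans_eq ?_
      rw [mul_assoc, thetaMajorant, thetaMajorant, ← Real.exp_add, ← Finset.sum_add_distrib]
      congr 2
      exact Finset.sum_congr rfl fun i _ => by ring
  simpa only [theta2SecondDeriv, theta2Exponent_add_smul_single] using h

/-- The heat equation for second order theta functions at `z = 0`. -/
lemma hasDerivAt_theta2_symmUnit {g : ℕ} (ε : Fin g → ℤ)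
    {τ : Matrix (Fin g) (Fin g) ℂ} (hτ : τ ∈ SiegelUpper g) (j k : Fin g) :
    HasDerivAt (fun s : ℂ => theta2 ε (τ + s • symmUnit j k) 0)
      ((4 * Real.pi * I)⁻¹ * theta2SecondDeriv ε τ j k) 0 := by
  obtain ⟨c, hc, hb⟩ := hτ.2.exists_quadraticLowerBound
  have h := hasDerivAt_tsum_mul_exp (c := 1) (a := theta2Exponent ε τ 0)
    (b := fun n => 4 * Real.pi * I * (thetaIndex ε n j * thetaIndex ε n k))
    (summable_thetaMajorant (by positivity : 0 < 2 * Real.pi * (c / 2))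
      (4 * Real.pi * 0) ε) (by positivity : 0 < c / 4) fun n s hs => by
        rw [Pi.one_apply, one_mul, ← theta2Exponent_add_smul_symmUnit]
        exact norm_exp_theta2Exponent_le
          (hb.add_smul_symmUnit j k (mem_ball_zero_iff.1 hs).le) norm_zero.le n
  have hval : (4 * Real.pi * I)⁻¹ * theta2SecondDeriv ε τ j k =
      ∑' n, 4 * Real.pi * I * (thetaIndex ε n j * thetaIndex ε n k) *
        exp (theta2Exponent ε τ 0 n) := by
    rw [theta2SecondDeriv, ← tsum_mul_left]
    refine tsum_congr fun n => ?_
    have := Real.pi_ne_zero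
    have := I_ne_zero
    field_simp
  simpa only [hval, Pi.one_apply, one_mul, theta2_eq_tsum,
    theta2Exponent_add_smul_symmUnit] using h

lemma dirDeriv_dirDeriv_sum_theta2 {g : ℕ} {ι : Type*} [Fintype ι] (a : ι → ℂ)
    (ε : ι → Fin g → ℤ) {τ : Matrix (Fin g) (Fin g) ℂ} (hτ : τ ∈ SiegelUpper g)
    (j k : Fin g) :
    dirDeriv j (dirDeriv k fun z => ∑ i, a i * theta2 (ε i) τ z) 0 =
      ∑ i, a i * theta2SecondDeriv (ε i) τ j k := by
  have h₁ : dirDeriv k (fun z => ∑ i, a i * theta2 (ε i) τ z) = fun z => ∑ i, a i *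
      ∑' n, 4 * Real.pi * I * thetaIndex (ε i) n k * exp (theta2Exponent (ε i) τ z n) :=
    funext fun z => (HasDerivAt.fun_sum fun i _ =>
      (hasDerivAt_theta2_single (ε i) hτ z k).const_mul (a i)).deriv
  rw [h₁]
  exact (HasDerivAt.fun_sum fun i _ =>
    (hasDerivAt_theta2_single_single (ε i) hτ j k).const_mul (a i)).deriv

/-- if I is a polynomial relation among the second order theta
constants, then f_I(z) = Σ_ε (∂I/∂x_ε)(Θ[·](τ,0)) Θ[ε](τ,z) has all second
partial derivatives vanishing at z = 0, and if I is homogeneous then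
f_I(0) = deg(I)·I(Θ[·](τ,0)) = 0 by Euler's formula; hence f_I ∈ Γ_00. -/
theorem relation_gives_Gamma00_element {g : ℕ}
    (I : MvPolynomial (Fin g → ZMod 2) ℂ)
    (hI : ∀ τ ∈ SiegelUpper g,
      MvPolynomial.eval (fun ε => theta2 (liftChar ε) τ 0) I = 0)
    (τ : Matrix (Fin g) (Fin g) ℂ) (hτ : τ ∈ SiegelUpper g) :
    let fI : (Fin g → ℂ) → ℂ := fun z =>
      ∑ ε : Fin g → ZMod 2,
        MvPolynomial.eval (fun ε' => theta2 (liftChar ε') τ 0)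
          (MvPolynomial.pderiv ε I) * theta2 (liftChar ε) τ z
    (∀ j k : Fin g, dirDeriv j (dirDeriv k fI) 0 = 0) ∧
    (∀ d : ℕ, I.IsHomogeneous d →
      fI 0 = (d : ℂ) * MvPolynomial.eval (fun ε => theta2 (liftChar ε) τ 0) I ∧
      fI 0 = 0) := by
  intro fI
  refine ⟨fun j k => ?_, fun d hd => ?_⟩
  · obtain ⟨c, hc, hb⟩ := hτ.2.exists_quadraticLowerBound
    have hD := I.hasDerivAt_eval fun ε => hasDerivAt_theta2_symmUnit (liftChar ε) hτ j k
    have hev : (fun s : ℂ => MvPolynomial.eval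
        (fun ε => theta2 (liftChar ε) (τ + s • symmUnit j k) 0) I) =ᶠ[nhds 0] fun _ => 0 := by
      filter_upwards [Metric.closedBall_mem_nhds (0 : ℂ) (by positivity : 0 < c / 4)] with s hs
      exact hI _ (add_smul_symmUnit_mem_SiegelUpper hc hτ.1 hb j k (mem_closedBall_zero_iff.1 hs))
    have h₀ := hD.unique ((hasDerivAt_const (0 : ℂ) (0 : ℂ)).congr_of_eventuallyEq hev)
    simp only [zero_smul, add_zero, mul_left_comm _ (4 * (Real.pi : ℂ) * Complex.I)⁻¹,
      ← Finset.mul_sum] at h₀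
    rw [dirDeriv_dirDeriv_sum_theta2 _ _ hτ]
    exact (mul_eq_zero.1 h₀).resolve_left (by simp [Real.pi_ne_zero])
  · have hE : fI 0 = d * MvPolynomial.eval (fun ε => theta2 (liftChar ε) τ 0) I := by
      have := congrArg (MvPolynomial.eval fun ε => theta2 (liftChar ε) τ 0)
        hd.sum_X_mul_pderiv
      simpa [fI, mul_comm] using this
    exact ⟨hE, by rw [hE, hI τ hτ, mul_zero]⟩
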